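/- arXiv:2511.20838 — 2 statements merged into one kernel-verified Lean document; each statement's English description precedes it below -/
import Mathlib

section
/- Let n, m, p be positive integers, let f : ℝⁿ → ℝⁿ, Ḡ : ℝⁿ → ℝ^{n×m}, h : ℝⁿ → ℝᵖ, J̄ : ℝⁿ → ℝ^{p×m} be continuous, let Q ∈ ℝ^{p×p} be symmetric and negative definite, S ∈ ℝ^{p×m}, R ∈ ℝ^{m×m} symmetric. Let Ω ⊆ X ⊆ ℝⁿ, let V : ℝⁿ → ℝ be continuously differentiable with V(x) ≥ 0 for all x ∈ X, and suppose that for every x ∈ X the symmetric block matrix M(x) = [[∇V(x)ᵀf(x), ½Ḡ(x)ᵀ∇V(x) − Sᵀh(x), h(x)ᵀ], [∗, −R − SᵀJ̄(x) − J̄(x)ᵀS, J̄(x)ᵀ], [∗, ∗, Q⁻¹]] is negative semidefinite. Then for every T ≥ 0, every continuous u : [0,T] → ℝ^m, and every differentiable trajectory x : [0,T] → ℝⁿ with x(0) ∈ Ω, x(t) ∈ X for all t ∈ [0,T], and x′(t) = f(x(t)) + Ḡ(x(t))u(t), setting y(t) = h(x(t)) + J̄(x(t))u(t), one has ∫₀ᵀ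 ( y(t)ᵀQy(t) + 2y(t)ᵀSu(t) + u(t)ᵀRu(t) ) dt ≥ −V(x(0)). -/
open Matrix

/-- The QSR Hamilton–Jacobi LMI block matrix
`M(x) = [[∇V(x)ᵀf(x), ½Ḡ(x)ᵀ∇V(x) − Sᵀh(x), h(x)ᵀ], [∗, −R − SᵀJ̄(x) − J̄(x)ᵀS, J̄(x)ᵀ], [∗, ∗, Q⁻¹]]`
built from the data `v = ∇V(x)`, `g = f(x)`, `h₀ = h(x)`, `G₀ = Ḡ(x)`, `J₀ = J̄(x)`. -/
noncomputable def qsrM {n m p : ℕ}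
    (v g : Fin n → ℝ) (h0 : Fin p → ℝ)
    (G0 : Matrix (Fin n) (Fin m) ℝ) (J0 : Matrix (Fin p) (Fin m) ℝ)
    (Q : Matrix (Fin p) (Fin p) ℝ) (S : Matrix (Fin p) (Fin m) ℝ)
    (R : Matrix (Fin m) (Fin m) ℝ) :
    Matrix (Unit ⊕ Fin m ⊕ Fin p) (Unit ⊕ Fin m ⊕ Fin p) ℝ :=
  Matrix.of fun i j =>
    match i, j with
    | Sum.inl _, Sum.inl _ => v ⬝ᵥ g
    | Sum.inl _, Sum.inr (Sum.inl k) => (1 / 2) * (G0ᵀ *ᵥ v) k - (Sᵀ *ᵥ h0) k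
    | Sum.inl _, Sum.inr (Sum.inr a) => h0 a
    | Sum.inr (Sum.inl k), Sum.inl _ => (1 / 2) * (G0ᵀ *ᵥ v) k - (Sᵀ *ᵥ h0) k
    | Sum.inr (Sum.inl k), Sum.inr (Sum.inl l) => (-R - Sᵀ * J0 - J0ᵀ * S) k l
    | Sum.inr (Sum.inl k), Sum.inr (Sum.inr a) => J0 a k
    | Sum.inr (Sum.inr a), Sum.inl _ => h0 a
    | Sum.inr (Sum.inr a), Sum.inr (Sum.inl k) => J0 a k
    | Sum.inr (Sum.inr a), Sum.inr (Sum.inr b) => Q⁻¹ a b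

theorem qsrM_mulVec {n m p : ℕ}
    (v g : Fin n → ℝ) (h0 : Fin p → ℝ)
    (G0 : Matrix (Fin n) (Fin m) ℝ) (J0 : Matrix (Fin p) (Fin m) ℝ)
    (Q : Matrix (Fin p) (Fin p) ℝ) (S : Matrix (Fin p) (Fin m) ℝ)
    (R : Matrix (Fin m) (Fin m) ℝ) (w : Fin m → ℝ) (z : Fin p → ℝ) :
    qsrM v g h0 G0 J0 Q S R *ᵥ Sum.elim (fun _ => 1) (Sum.elim w z) =
      Sum.elim (fun _ => v ⬝ᵥ g + (((1 / 2 : ℝ) • (G0ᵀ *ᵥ v) - Sᵀ *ᵥ h0) ⬝ᵥ w + h0 ⬝ᵥ z))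
        (Sum.elim
          (((1 / 2 : ℝ) • (G0ᵀ *ᵥ v) - Sᵀ *ᵥ h0) +
            ((-R - Sᵀ * J0 - J0ᵀ * S) *ᵥ w + J0ᵀ *ᵥ z))
          (h0 + (J0 *ᵥ w + Q⁻¹ *ᵥ z))) := by
  ext i
  rcases i with i | i | i <;>
    simp [mulVec, dotProduct, qsrM, Fintype.sum_sum_type]

theorem qsrM_quadForm {n m p : ℕ}
    (v g : Fin n → ℝ) (h0 : Fin p → ℝ)
    (G0 : Matrix (Fin n) (Fin m) ℝ) (J0 : Matrix (Fin p) (Fin m) ℝ)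
    (Q : Matrix (Fin p) (Fin p) ℝ) (S : Matrix (Fin p) (Fin m) ℝ)
    (R : Matrix (Fin m) (Fin m) ℝ) (w : Fin m → ℝ) (z : Fin p → ℝ) :
    Sum.elim (fun _ => 1) (Sum.elim w z) ⬝ᵥ
        (qsrM v g h0 G0 J0 Q S R *ᵥ Sum.elim (fun _ => 1) (Sum.elim w z)) =
      v ⬝ᵥ (g + G0 *ᵥ w) - 2 * ((h0 + J0 *ᵥ w) ⬝ᵥ (S *ᵥ w)) - w ⬝ᵥ (R *ᵥ w)
        + 2 * ((h0 + J0 *ᵥ w) ⬝ᵥ z) + z ⬝ᵥ (Q⁻¹ *ᵥ z) := by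
  have transpose_pair {k l : ℕ} (A : Matrix (Fin k) (Fin l) ℝ) (a : Fin k → ℝ) (b : Fin l → ℝ) :
      (Aᵀ *ᵥ a) ⬝ᵥ b = a ⬝ᵥ (A *ᵥ b) := by
    rw [mulVec_transpose, dotProduct_mulVec]
  have transpose_pair' {k l : ℕ} (A : Matrix (Fin k) (Fin l) ℝ) (a : Fin k → ℝ) (b : Fin l → ℝ) :
      b ⬝ᵥ (Aᵀ *ᵥ a) = a ⬝ᵥ (A *ᵥ b) := by
    rw [dotProduct_comm, transpose_pair]
  rw [qsrM_mulVec, sumElim_dotProduct_sumElim, sumElim_dotProduct_sumElim]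
  simp only [dotProduct_add, add_dotProduct, dotProduct_sub, sub_dotProduct, dotProduct_smul,
    smul_dotProduct, sub_mulVec, neg_mulVec, dotProduct_neg, ← mulVec_mulVec, transpose_pair,
    transpose_pair', smul_eq_mul]
  rw [dotProduct_comm z h0, dotProduct_comm z (J0 *ᵥ w), dotProduct_comm (S *ᵥ w) (J0 *ᵥ w)]
  simp [dotProduct]
  ring

/-- Along the dynamics, the LMI bounds the derivative of the storage function by the supply rate. -/
theorem storage_rate_le_supply_of_qsrM {n m p : ℕ}
    (v g : Fin n → ℝ) (h0 : Fin p → ℝ)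
    (G0 : Matrix (Fin n) (Fin m) ℝ) (J0 : Matrix (Fin p) (Fin m) ℝ)
    (Q : Matrix (Fin p) (Fin p) ℝ) (S : Matrix (Fin p) (Fin m) ℝ)
    (R : Matrix (Fin m) (Fin m) ℝ) (hQ : IsUnit Q.det)
    (hM : (-(qsrM v g h0 G0 J0 Q S R)).PosSemidef) (w : Fin m → ℝ) :
    v ⬝ᵥ (g + G0 *ᵥ w) ≤
      (h0 + J0 *ᵥ w) ⬝ᵥ (Q *ᵥ (h0 + J0 *ᵥ w)) + 2 * ((h0 + J0 *ᵥ w) ⬝ᵥ (S *ᵥ w)) +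
        w ⬝ᵥ (R *ᵥ w) := by
  set y := h0 + J0 *ᵥ w with hy
  have key := hM.dotProduct_mulVec_nonneg (Sum.elim (fun _ => 1) (Sum.elim w (-(Q *ᵥ y))))
  rw [star_trivial, neg_mulVec, dotProduct_neg, qsrM_quadForm, ← hy] at key
  have hinv : Q⁻¹ *ᵥ (Q *ᵥ y) = y := by
    rw [mulVec_mulVec, nonsing_inv_mul Q hQ, one_mulVec]
  rw [mulVec_neg, hinv, dotProduct_neg, neg_dotProduct_neg, dotProduct_comm (Q *ᵥ y) y] at key
  linarith

/-- the unnumbered theorem of Section 4.1 of the paper: if the QSR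
Hamilton–Jacobi LMI holds on `X`, `Ω ⊆ X`, and a trajectory starts in `Ω` and stays
in `X` on `[0,T]`, then `∫₀ᵀ (yᵀQy + 2yᵀSu + uᵀRu) dt ≥ −V(x(0))`, i.e. the local
QSR dissipativity inequality holds with `β = −V(x(0))`. -/
theorem qsr_lmi_implies_local_dissipativity {n m p : ℕ}
    (hn : 0 < n) (hm : 0 < m) (hp : 0 < p)
    (f : (Fin n → ℝ) → (Fin n → ℝ)) (hf : Continuous f)
    (Gb : (Fin n → ℝ) → Matrix (Fin n) (Fin m) ℝ) (hGb : Continuous Gb)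
    (hfun : (Fin n → ℝ) → (Fin p → ℝ)) (hh : Continuous hfun)
    (Jb : (Fin n → ℝ) → Matrix (Fin p) (Fin m) ℝ) (hJb : Continuous Jb)
    (Q : Matrix (Fin p) (Fin p) ℝ) (hQsymm : Q.IsSymm) (hQneg : (-Q).PosDef)
    (S : Matrix (Fin p) (Fin m) ℝ)
    (R : Matrix (Fin m) (Fin m) ℝ) (hRsymm : R.IsSymm)
    (Ω X : Set (Fin n → ℝ)) (hΩX : Ω ⊆ X)
    (V : (Fin n → ℝ) → ℝ)
    (gradV : (Fin n → ℝ) → (Fin n → ℝ))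
    (DV : (Fin n → ℝ) → ((Fin n → ℝ) →L[ℝ] ℝ))
    (hV : ∀ pt, HasFDerivAt V (DV pt) pt)
    (hDV : ∀ pt w, DV pt w = gradV pt ⬝ᵥ w)
    (hgradV : Continuous gradV)
    (hVnonneg : ∀ x ∈ X, 0 ≤ V x)
    (hLMI : ∀ x ∈ X,
      (-(qsrM (gradV x) (f x) (hfun x) (Gb x) (Jb x) Q S R)).PosSemidef) :
    ∀ T : ℝ, 0 ≤ T →
    ∀ u : ℝ → (Fin m → ℝ), ContinuousOn u (Set.Icc 0 T) →
    ∀ x : ℝ → (Fin n → ℝ),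
      x 0 ∈ Ω →
      (∀ t ∈ Set.Icc 0 T, x t ∈ X) →
      (∀ t ∈ Set.Icc 0 T, HasDerivAt x (f (x t) + (Gb (x t)) *ᵥ (u t)) t) →
      -(V (x 0)) ≤ ∫ t in (0 : ℝ)..T,
        ((hfun (x t) + (Jb (x t)) *ᵥ u t) ⬝ᵥ (Q *ᵥ (hfun (x t) + (Jb (x t)) *ᵥ u t)) +
          2 * ((hfun (x t) + (Jb (x t)) *ᵥ u t) ⬝ᵥ (S *ᵥ u t)) +
          (u t) ⬝ᵥ (R *ᵥ (u t))) := by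
  intro T hT u hu x hx0 hxX hx
  have hQ : IsUnit Q.det := by
    rw [← isUnit_iff_isUnit_det]
    simpa using hQneg.isUnit.neg
  have hxc : ContinuousOn x (Set.Icc 0 T) := fun t ht => (hx t ht).continuousAt.continuousWithinAt
  have mulVec_cont {k : ℕ} {A : (Fin n → ℝ) → Matrix (Fin k) (Fin m) ℝ} (hA : Continuous A) :
      ContinuousOn (fun t => A (x t) *ᵥ u t) (Set.Icc 0 T) :=
    (continuous_fst.matrix_mulVec continuous_snd).comp_continuousOn
      ((hA.comp_continuousOn hxc).prodMk hu)
  have dot_cont {k : ℕ} {a b : ℝ → Fin k → ℝ} (ha : ContinuousOn a (Set.Icc 0 T))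
      (hb : ContinuousOn b (Set.Icc 0 T)) :
      ContinuousOn (fun t => a t ⬝ᵥ b t) (Set.Icc 0 T) :=
    (continuous_fst.dotProduct continuous_snd).comp_continuousOn (ha.prodMk hb)
  have const_cont {k l : ℕ} (A : Matrix (Fin k) (Fin l) ℝ) {b : ℝ → Fin l → ℝ}
      (hb : ContinuousOn b (Set.Icc 0 T)) :
      ContinuousOn (fun t => A *ᵥ b t) (Set.Icc 0 T) :=
    (continuous_const.matrix_mulVec continuous_id).comp_continuousOn hb
  have hy : ContinuousOn (fun t => hfun (x t) + Jb (x t) *ᵥ u t) (Set.Icc 0 T) :=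
    (hh.comp_continuousOn hxc).add (mulVec_cont hJb)
  have hrate : ContinuousOn (fun t => gradV (x t) ⬝ᵥ (f (x t) + Gb (x t) *ᵥ u t))
      (Set.Icc 0 T) :=
    dot_cont (hgradV.comp_continuousOn hxc) ((hf.comp_continuousOn hxc).add (mulVec_cont hGb))
  have hsupply := ((dot_cont hy (const_cont Q hy)).add
    ((dot_cont hy (const_cont S hu)).const_mul 2)).add (dot_cont hu (const_cont R hu))
  have hftc : ∫ t in (0 : ℝ)..T, gradV (x t) ⬝ᵥ (f (x t) + Gb (x t) *ᵥ u t) =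
      V (x T) - V (x 0) := by
    refine intervalIntegral.integral_eq_sub_of_hasDerivAt (f := fun t => V (x t))
      (fun t ht => ?_) (hrate.intervalIntegrable_of_Icc hT)
    rw [Set.uIcc_of_le hT] at ht
    rw [← hDV]
    exact (hV (x t)).comp_hasDerivAt t (hx t ht)
  calc -(V (x 0)) ≤ V (x T) - V (x 0) := by
        linarith [hVnonneg _ (hxX T (Set.right_mem_Icc.2 hT))]
    _ = ∫ t in (0 : ℝ)..T, gradV (x t) ⬝ᵥ (f (x t) + Gb (x t) *ᵥ u t) := hftc.symm
    _ ≤ _ := intervalIntegral.integral_mono_on hT (hrate.intervalIntegrable_of_Icc hT)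
        (hsupply.intervalIntegrable_of_Icc hT) fun t ht =>
          storage_rate_le_supply_of_qsrM _ _ _ _ _ _ _ _ hQ (hLMI _ (hxX t ht)) _
end

section
/- Let n, m be positive integers, ε > 0, and let θ : ℝⁿ → ℝⁿ and ζ : ℝⁿ → ℝ^m be twice continuously differentiable with θ(0) = 0 and ζ(0) = 0. Let J_θ ∈ ℝ^{n×n} and J_ζ ∈ ℝ^{m×n} be the Jacobian matrices of θ and ζ at 0. Let Π ∈ ℝ^{m×m} be diagonal and positive definite with largest diagonal entry π_M. Suppose θ̂, ζ̂ ≥ 0 are such that for every x in the closed Euclidean ball B_ε(0) there exist matrices A₂ ∈ ℝ^{m×n} and B₂ ∈ ℝ^{n×n} with ζ(x) = (J_ζ + ½A₂)x, θ(x) = (J_θ + ½B₂)x, ‖A₂‖₂ ≤ ζ̂ε, and ‖B₂‖₂ ≤ θ̂ε (where ‖·‖₂ is the spectral norm). If the symmetric (n+m)×(n+m) block matrix [[½(J_θ + J_θᵀ) + ½(θ̂ε + ζ̂²ε²π_M)·I_n, J_ζᵀ], [J_ζ, −I_m + ½Π⁻¹]] is negative semidefinite, then for every x ∈ B_ε(0),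 ζ(x)ᵀζ(x) + xᵀθ(x) ≤ 0. -/
open Matrix

/-- The Euclidean (2-)norm of a finitely indexed real vector. -/
noncomputable def norm2 {ι : Type*} [Fintype ι] (v : ι → ℝ) : ℝ :=
  Real.sqrt (∑ i, v i ^ 2)

theorem norm2_nonneg {ι : Type*} [Fintype ι] (v : ι → ℝ) : 0 ≤ norm2 v :=
  Real.sqrt_nonneg _

theorem norm2_sq {ι : Type*} [Fintype ι] (v : ι → ℝ) : norm2 v ^ 2 = v ⬝ᵥ v := by
  rw [norm2, Real.sq_sqrt (Finset.sum_nonneg fun i _ => sq_nonneg (v i))]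
  simp only [dotProduct, sq]

/-- The Cauchy-Schwarz inequality for `norm2`. -/
theorem dotProduct_le_norm2_mul_norm2 {ι : Type*} [Fintype ι] (v w : ι → ℝ) :
    v ⬝ᵥ w ≤ norm2 v * norm2 w :=
  Real.sum_mul_le_sqrt_mul_sqrt _ _ _

/-- Weighted Young inequality for the dot product. -/
theorem dotProduct_le_weighted {ι : Type*} [Fintype ι] [DecidableEq ι] {d : ι → ℝ} {c : ℝ}
    (hd : ∀ i, 0 < d i) (hc : ∀ i, d i ≤ c) (z a : ι → ℝ) :
    z ⬝ᵥ a ≤ (1 / 2) * (z ⬝ᵥ ((diagonal d)⁻¹ *ᵥ z)) + (1 / 2) * (c * (a ⬝ᵥ a)) := by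
  have hinv : (diagonal d)⁻¹ = diagonal fun i => (d i)⁻¹ := by
    refine inv_eq_right_inv ?_
    simp [diagonal_mul_diagonal, fun i => mul_inv_cancel₀ (hd i).ne']
  simp only [hinv, dotProduct, mulVec_diagonal, Finset.mul_sum, ← Finset.sum_add_distrib]
  refine Finset.sum_le_sum fun i _ => ?_
  have hi := hd i
  have hsq : 0 ≤ (d i)⁻¹ * (z i - d i * a i) ^ 2 := by positivity
  have hexp : (d i)⁻¹ * (z i - d i * a i) ^ 2 =
      z i * ((d i)⁻¹ * z i) - 2 * (z i * a i) + d i * (a i * a i) := by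
    field_simp
    ring
  have hle := mul_le_mul_of_nonneg_right (hc i) (mul_self_nonneg (a i))
  linarith

/-- The quadratic form of a negative semidefinite symmetric block matrix. -/
theorem dotProduct_fromBlocks_nonpos {m n : Type*} [Fintype m] [Fintype n]
    {A : Matrix n n ℝ} {B : Matrix m n ℝ} {D : Matrix m m ℝ}
    (h : (-(fromBlocks A Bᵀ B D)).PosSemidef) (x : n → ℝ) (y : m → ℝ) :
    x ⬝ᵥ (A *ᵥ x) + 2 * (y ⬝ᵥ (B *ᵥ x)) + y ⬝ᵥ (D *ᵥ y) ≤ 0 := by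
  have hq := h.dotProduct_mulVec_nonneg (Sum.elim x y)
  have ht : x ⬝ᵥ (Bᵀ *ᵥ y) = y ⬝ᵥ (B *ᵥ x) := by
    rw [mulVec_transpose, dotProduct_comm, dotProduct_mulVec]
  simp only [star_trivial, neg_mulVec, dotProduct_neg, fromBlocks_mulVec, Sum.elim_comp_inl,
    Sum.elim_comp_inr, sumElim_dotProduct_sumElim, dotProduct_add, ht] at hq
  linarith

/-- Theorem 4 of the paper: for `C²` maps `θ`, `ζ` vanishing at the
origin, with Jacobians `J_θ`, `J_ζ` at `0`, a diagonal positive definite `Π` with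
largest diagonal entry `π_M`, and Taylor-remainder factorizations
`ζ(x) = (J_ζ + ½A₂)x`, `θ(x) = (J_θ + ½B₂)x` with spectral-norm bounds
`‖A₂‖₂ ≤ ζ̂ε`, `‖B₂‖₂ ≤ θ̂ε` on the closed Euclidean ball `B_ε(0)` (operator-norm
bounds expressed vectorwise), if the LMI
`[[½(J_θ + J_θᵀ) + ½(θ̂ε + ζ̂²ε²π_M)I_n, J_ζᵀ], [J_ζ, −I_m + ½Π⁻¹]] ⪯ 0`
holds, then `ζ(x)ᵀζ(x) + xᵀθ(x) ≤ 0` for every `x ∈ B_ε(0)`. -/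
theorem quadratic_ball_lmi {n m : ℕ} (hn : 0 < n) (hm : 0 < m)
    (ε : ℝ) (hε : 0 < ε)
    (θ : (Fin n → ℝ) → (Fin n → ℝ)) (hθ : ContDiff ℝ 2 θ)
    (ζ : (Fin n → ℝ) → (Fin m → ℝ)) (hζ : ContDiff ℝ 2 ζ)
    (hθ0 : θ 0 = 0) (hζ0 : ζ 0 = 0)
    (Jθ : Matrix (Fin n) (Fin n) ℝ) (hJθ : ∀ v, Jθ *ᵥ v = fderiv ℝ θ 0 v)
    (Jζ : Matrix (Fin m) (Fin n) ℝ) (hJζ : ∀ v, Jζ *ᵥ v = fderiv ℝ ζ 0 v)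
    (Pim : Matrix (Fin m) (Fin m) ℝ) (hPimDiag : Pim.IsDiag) (hPimPos : Pim.PosDef)
    (πM : ℝ) (hπM : IsGreatest (Set.range fun k => Pim k k) πM)
    (θhat ζhat : ℝ) (hθhat0 : 0 ≤ θhat) (hζhat0 : 0 ≤ ζhat)
    (hfact : ∀ x : Fin n → ℝ, norm2 x ≤ ε →
      ∃ (A₂ : Matrix (Fin m) (Fin n) ℝ) (B₂ : Matrix (Fin n) (Fin n) ℝ),
        ζ x = (Jζ + (1 / 2 : ℝ) • A₂) *ᵥ x ∧
        θ x = (Jθ + (1 / 2 : ℝ) • B₂) *ᵥ x ∧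
        (∀ v, norm2 (A₂ *ᵥ v) ≤ ζhat * ε * norm2 v) ∧
        (∀ v, norm2 (B₂ *ᵥ v) ≤ θhat * ε * norm2 v))
    (hLMI : (-(Matrix.fromBlocks
        ((1 / 2 : ℝ) • (Jθ + Jθᵀ) +
          ((1 / 2) * (θhat * ε + ζhat ^ 2 * ε ^ 2 * πM)) •
            (1 : Matrix (Fin n) (Fin n) ℝ))
        Jζᵀ Jζ
        ((-1 : Matrix (Fin m) (Fin m) ℝ) + (1 / 2 : ℝ) • Pim⁻¹))).PosSemidef) :
    ∀ x : Fin n → ℝ, norm2 x ≤ ε → ζ x ⬝ᵥ ζ x + x ⬝ᵥ θ x ≤ 0 := by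
  intro x hx
  obtain ⟨A₂, B₂, hζx, hθx, hA, hB⟩ := hfact x hx
  have hd : ∀ k, 0 < Pim k k := fun k => hPimPos.diag_pos
  have hle : ∀ k, Pim k k ≤ πM := fun k => hπM.2 ⟨k, rfl⟩
  have hπ : 0 ≤ πM := (hd ⟨0, hm⟩).le.trans (hle _)
  have hdiag : diagonal (fun k => Pim k k) = Pim := hPimDiag.diagonal_diag
  have hyoung := dotProduct_le_weighted hd hle (ζ x) (A₂ *ᵥ x)
  rw [hdiag] at hyoung
  have hAx : (A₂ *ᵥ x) ⬝ᵥ (A₂ *ᵥ x) ≤ ζhat ^ 2 * ε ^ 2 * (x ⬝ᵥ x) := by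
    have hsq := pow_le_pow_left₀ (norm2_nonneg _) (hA x) 2
    rw [mul_pow, mul_pow, norm2_sq, norm2_sq] at hsq
    exact hsq
  have hBx : x ⬝ᵥ (B₂ *ᵥ x) ≤ θhat * ε * (x ⬝ᵥ x) := by
    have hmul := mul_le_mul_of_nonneg_left (hB x) (norm2_nonneg x)
    rw [← norm2_sq]
    linarith [dotProduct_le_norm2_mul_norm2 x (B₂ *ᵥ x)]
  have hπA := mul_le_mul_of_nonneg_left hAx hπ
  have hform := dotProduct_fromBlocks_nonpos hLMI x (ζ x)
  have hJt : x ⬝ᵥ (Jθᵀ *ᵥ x) = x ⬝ᵥ (Jθ *ᵥ x) := by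
    rw [mulVec_transpose, dotProduct_comm, dotProduct_mulVec]
  have hJx : Jζ *ᵥ x = ζ x - (1 / 2 : ℝ) • (A₂ *ᵥ x) := by
    rw [hζx, add_mulVec, smul_mulVec, add_sub_cancel_right]
  simp only [hJx, add_mulVec, smul_mulVec, neg_mulVec, one_mulVec, dotProduct_add,
    dotProduct_sub, dotProduct_smul, dotProduct_neg, smul_eq_mul, hJt] at hform
  have hθform : x ⬝ᵥ θ x = x ⬝ᵥ (Jθ *ᵥ x) + 1 / 2 * (x ⬝ᵥ (B₂ *ᵥ x)) := by
    rw [hθx, add_mulVec, smul_mulVec, dotProduct_add, dotProduct_smul, smul_eq_mul]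
  linarith
end
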